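/- Let K be an algebraically closed field of characteristic zero, let n ≥ 2 be an integer, and set M = 2·n²·(n+1)·C(3n−1, n). Let F(t) = t^n + a_{n−1}·t^{n−1} + ⋯ + a_1·t + a_0 ∈ (K[x])[t] be a monic polynomial of degree n with coefficients a_i ∈ K[x]. If there are at least M values λ ∈ K such that F(λ) is an n-th power in K[x], then either all the coefficients a_0, …, a_{n−1} lie in K, or there exists ν ∈ K[x] such that F(t) = (t + ν)^n. -/

import Mathlib

open Polynomial

section Bivariate

variable {R : Type*} [CommRing R]

/-- The derivative of a bivariate polynomial with respect to the inner variable. -/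
noncomputable def coeffDeriv (p : R[X][X]) : R[X][X] :=
  Bivariate.swap (derivative (Bivariate.swap p))

lemma coeff_coeff_swap (p : R[X][X]) (i j : ℕ) :
    ((Bivariate.swap p).coeff i).coeff j = (p.coeff j).coeff i := by
  induction p using Polynomial.induction_on' with
  | add p q hp hq => simp [hp, hq]
  | monomial k f =>
    rw [Bivariate.swap_monomial, coeff_mul_C, coeff_map, coeff_C_mul, coeff_X_pow, coeff_monomial]
    split_ifs <;> simp_all

lemma coeff_coeffDeriv (p : R[X][X]) (i : ℕ) :
    (coeffDeriv p).coeff i = derivative (p.coeff i) := by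
  ext j
  rw [coeffDeriv, coeff_coeff_swap, coeff_derivative, coeff_derivative, ← Nat.cast_succ,
    ← C_eq_natCast, coeff_mul_C, coeff_coeff_swap, Nat.cast_succ]

lemma coeffDeriv_mul (p q : R[X][X]) :
    coeffDeriv (p * q) = coeffDeriv p * q + p * coeffDeriv q := by
  simp [coeffDeriv, derivative_mul, Bivariate.swap_swap_apply]

lemma coeffDeriv_one : coeffDeriv (1 : R[X][X]) = 0 := by
  simp [coeffDeriv]

lemma natDegree_coeffDeriv_le (p : R[X][X]) : (coeffDeriv p).natDegree ≤ p.natDegree :=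
  natDegree_le_iff_coeff_eq_zero.2 fun i hi => by
    rw [coeff_coeffDeriv, coeff_eq_zero_of_natDegree_lt hi, derivative_zero]

lemma degree_coeffDeriv_lt [Nontrivial R] {p : R[X][X]} (hp : p.Monic) :
    (coeffDeriv p).degree < p.degree := by
  rw [degree_eq_natDegree hp.ne_zero, degree_lt_iff_coeff_zero]
  intro i hi
  rw [coeff_coeffDeriv]
  rcases hi.eq_or_lt with rfl | hi
  · rw [hp.coeff_natDegree, derivative_one]
  · rw [coeff_eq_zero_of_natDegree_lt hi, derivative_zero]

lemma eval_C_coeffDeriv (p : R[X][X]) (c : R) :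
    (coeffDeriv p).eval (C c) = derivative (p.eval (C c)) := by
  rw [eval_eq_sum_range' (Nat.lt_succ_of_le (natDegree_coeffDeriv_le p)), eval_eq_sum_range]
  simp only [derivative_sum, coeff_coeffDeriv, derivative_mul, ← C_pow, derivative_C, mul_zero,
    add_zero]

lemma eval_eval_C (p : R[X][X]) (c x : R) :
    (p.eval (C c)).eval x = (p.map (evalRingHom x)).eval c := by
  rw [eval_map, ← coe_evalRingHom, ← eval₂_hom, coe_evalRingHom, eval_C]

lemma coeff_eval_C (p : R[X][X]) (c : R) (h : ℕ) :
    (p.eval (C c)).coeff h = ((Bivariate.swap p).coeff h).eval c := by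
  rw [eval_eq_sum_range, finsetSum_coeff, eval_eq_sum_range'
    (n := p.natDegree + 1)]
  · simp only [← C_pow, coeff_mul_C, coeff_coeff_swap]
  · rw [Nat.lt_succ_iff, natDegree_le_iff_coeff_eq_zero]
    intro i hi
    rw [coeff_coeff_swap, coeff_eq_zero_of_natDegree_lt hi, coeff_zero]

lemma natDegree_det_le {ι : Type*} [Fintype ι] [DecidableEq ι] (A : Matrix ι ι R[X]) (h : ℕ)
    (hA : ∀ i j, (A i j).natDegree ≤ h) : A.det.natDegree ≤ Fintype.card ι * h := by
  rw [Matrix.det_apply]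
  refine natDegree_sum_le_of_forall_le _ _ fun σ _ => ?_
  refine (natDegree_smul_le _ _).trans ((natDegree_prod_le _ _).trans ?_)
  simpa using Finset.sum_le_card_nsmul Finset.univ _ h fun i _ => hA (σ i) i

/-- The degree of a resultant is at most the size of the Sylvester matrix times the largest degree
of a coefficient. -/
lemma natDegree_resultant_le (p q : R[X][X]) (m n h : ℕ) (hp : ∀ i, (p.coeff i).natDegree ≤ h)
    (hq : ∀ i, (q.coeff i).natDegree ≤ h) : (resultant p q m n).natDegree ≤ (m + n) * h := by
  have := natDegree_det_le (sylvester p q m n) h fun i j => by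
    induction j using Fin.addCases <;> simp only [sylvester, Matrix.of_apply, Fin.addCases_left,
      Fin.addCases_right] <;> split_ifs <;> simp [hp, hq]
  simpa [resultant] using this

end Bivariate

lemma not_dvd_coeffDeriv_prod {K : Type*} [Field K] {T : Finset K[X][X]}
    (hmon : ∀ g ∈ T, g.Monic) (hirr : ∀ g ∈ T, Irreducible g) (hne : ∀ g ∈ T, coeffDeriv g ≠ 0)
    {g : K[X][X]} (hg : g ∈ T) : ¬ g ∣ coeffDeriv (∏ f ∈ T, f) := by
  classical
  have hp := (hirr g hg).prime
  rw [← Finset.mul_prod_erase T (fun f => f) hg, coeffDeriv_mul,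
    dvd_add_left (dvd_mul_right _ _)]
  intro h
  rcases hp.dvd_or_dvd h with h | h
  · exact hne g hg (eq_zero_of_dvd_of_degree_lt h (degree_coeffDeriv_lt (hmon g hg)))
  · obtain ⟨f, hf, hgf⟩ := (hp.dvd_finsetProd_iff _).1 h
    rw [Finset.mem_erase] at hf
    have := ((hirr g hg).associated_of_dvd (hirr f hf.2) hgf)
    exact hf.1 (eq_of_monic_of_associated (hmon g hg) (hmon f hf.2) this).symm

lemma resultant_coeffDeriv_prod_ne_zero {K : Type*} [Field K] {T : Finset K[X][X]}
    (hmon : ∀ g ∈ T, g.Monic) (hirr : ∀ g ∈ T, Irreducible g)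
    (hne : ∀ g ∈ T, coeffDeriv g ≠ 0) :
    resultant (∏ f ∈ T, f) (coeffDeriv (∏ f ∈ T, f)) ≠ 0 := by
  have hinj := IsFractionRing.injective K[X] (FractionRing K[X])
  intro h
  have := congrArg (algebraMap K[X] (FractionRing K[X])) h
  rw [← resultant_map_map, map_zero, ← natDegree_map_eq_of_injective hinj,
    ← natDegree_map_eq_of_injective hinj (coeffDeriv _), resultant_eq_zero_iff] at this
  refine this.2 ?_
  rw [Polynomial.map_prod]
  refine IsCoprime.prod_left fun g hg => ?_
  rw [((hmon g hg).irreducible_iff_irreducible_map_fraction_map.1 (hirr g hg)).coprime_iff_not_dvd,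
    map_dvd_map _ hinj (hmon g hg)]
  exact not_dvd_coeffDeriv_prod hmon hirr hne hg

lemma Polynomial.Monic.exists_multiset_prod {R : Type*} [CommRing R] [IsDomain R] {F : R[X]}
    (hF : F.Monic) : ∃ s : Multiset R[X], (∀ g ∈ s, g.Monic ∧ Irreducible g) ∧ s.prod = F := by
  induction hd : F.natDegree using Nat.strong_induction_on generalizing F with
  | _ d ih =>
    by_cases h1 : F = 1
    · exact ⟨0, by simp, by simp [h1]⟩
    by_cases hirr : Irreducible F
    · exact ⟨{F}, by simp [hF, hirr], by simp⟩
    rw [irreducible_of_monic hF h1] at hirr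
    push Not at hirr
    obtain ⟨f, g, hf, hg, rfl, hf1, hg1⟩ := hirr
    have hfd := hf.natDegree_pos.2 hf1
    have hgd := hg.natDegree_pos.2 hg1
    rw [hf.natDegree_mul hg] at hd
    obtain ⟨s, hs, rfl⟩ := ih _ (by omega) hf rfl
    obtain ⟨t, ht, rfl⟩ := ih _ (by omega) hg rfl
    refine ⟨s + t, fun g hg => ?_, Multiset.prod_add s t⟩
    rcases Multiset.mem_add.1 hg with hg | hg
    exacts [hs g hg, ht g hg]

/-- If `G` and its derivative in the inner variable are coprime, then few specializations `G(c)` of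
full degree have only multiple roots: each such root is a root of the resultant, and a given root
occurs for at most `deg G` values of `c`. -/
lemma card_le_of_forall_root_multiple {K : Type*} [Field K] [IsAlgClosed K]
    {G : K[X][X]} (hG : G.Monic) (hres : resultant G (coeffDeriv G) ≠ 0) {h : ℕ} (h0 : 0 < h)
    (hdeg : ∀ i, (G.coeff i).natDegree ≤ h) {S : Finset K}
    (hS : ∀ c ∈ S, (G.eval (C c)).natDegree = h)
    (hroot : ∀ c ∈ S, ∀ x, (G.eval (C c)).IsRoot x → (X - C x) ^ 2 ∣ G.eval (C c)) :
    S.card ≤ 4 * G.natDegree ^ 2 := by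
  classical
  set Q := resultant G (coeffDeriv G) with hQ
  have hQdeg : Q.natDegree ≤ (G.natDegree + G.natDegree) * h := by
    refine (natDegree_resultant_le _ _ _ _ h hdeg fun i => ?_).trans ?_
    · rw [coeff_coeffDeriv]
      exact (natDegree_derivative_le _).trans ((Nat.sub_le _ _).trans (hdeg i))
    · gcongr
      exact natDegree_coeffDeriv_le G
  have hmul : ∀ c ∈ S, ∀ x, (G.eval (C c)).rootMultiplicity x ≤
      if (G.map (evalRingHom x)).IsRoot c then 2 * Q.rootMultiplicity x else 0 := by
    intro c hc x
    have hne : G.eval (C c) ≠ 0 := by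
      intro h'
      have := hS c hc
      simp [h'] at this
      omega
    have hd0 : G.natDegree ≠ 0 := by
      intro h'
      have := hS c hc
      rw [eq_one_of_monic_natDegree_zero hG h', eval_one, natDegree_one] at this
      omega
    split_ifs with hx
    · have hr : (G.eval (C c)).IsRoot x := by rwa [IsRoot, eval_eval_C]
      have h2 := (le_rootMultiplicity_iff hne).2 (hroot c hc x hr)
      obtain ⟨p, q, -, -, hpq⟩ := exists_mul_add_mul_eq_C_resultant G (coeffDeriv G) le_rfl le_rfl
        (Or.inl hd0)
      have hev := congrArg (eval (C c)) hpq
      rw [eval_add, eval_mul, eval_mul, eval_C, eval_C_coeffDeriv] at hev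
      have hd := pow_rootMultiplicity_dvd (G.eval (C c)) x
      have : (G.eval (C c)).rootMultiplicity x - 1 ≤ Q.rootMultiplicity x := by
        rw [le_rootMultiplicity_iff hres, hQ, ← hev]
        exact dvd_add (((pow_dvd_pow _ (Nat.sub_le _ _)).trans hd).mul_right _)
          ((pow_sub_one_dvd_derivative_of_pow_dvd hd).mul_right _)
      omega
    · rw [Nat.le_zero, rootMultiplicity_eq_zero]
      rwa [IsRoot, eval_eval_C]
  have hsum : ∀ c ∈ S, h ≤ ∑ x ∈ Q.roots.toFinset,
      if (G.map (evalRingHom x)).IsRoot c then 2 * Q.rootMultiplicity x else 0 := by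
    intro c hc
    rw [← hS c hc, ← splits_iff_card_roots.1 (IsAlgClosed.splits (G.eval (C c))),
      ← Multiset.sum_count_eq_card (s := Q.roots.toFinset)]
    · exact Finset.sum_le_sum fun x _ => by rw [count_roots]; exact hmul c hc x
    · intro x hx
      have h1 := hmul c hc x
      have h2 : 0 < (G.eval (C c)).rootMultiplicity x := by
        rwa [← count_roots, Multiset.count_pos]
      rw [Multiset.mem_toFinset, ← Multiset.count_pos, count_roots]
      split_ifs at h1 <;> omega
  have hcount : ∀ x, (S.filter fun c => (G.map (evalRingHom x)).IsRoot c).card ≤ G.natDegree := by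
    intro x
    have hm := hG.map (evalRingHom x)
    refine (card_le_degree_of_subset_roots (p := G.map (evalRingHom x)) fun c hc => ?_).trans
      natDegree_map_le
    rw [mem_roots hm.ne_zero]
    exact (Finset.mem_filter.1 hc).2
  have : S.card * h ≤ 4 * G.natDegree ^ 2 * h :=
    calc S.card * h = ∑ c ∈ S, h := by simp
      _ ≤ ∑ c ∈ S, ∑ x ∈ Q.roots.toFinset,
          if (G.map (evalRingHom x)).IsRoot c then 2 * Q.rootMultiplicity x else 0 :=
        Finset.sum_le_sum hsum
      _ = ∑ x ∈ Q.roots.toFinset,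
          (S.filter fun c => (G.map (evalRingHom x)).IsRoot c).card * (2 * Q.rootMultiplicity x) := by
        rw [Finset.sum_comm]
        simp [Finset.sum_ite]
      _ ≤ ∑ x ∈ Q.roots.toFinset, G.natDegree * (2 * Q.rootMultiplicity x) := by
        gcongr; exact hcount _
      _ = 2 * G.natDegree * Q.roots.card := by
        rw [← Multiset.toFinset_sum_count_eq, Finset.mul_sum]
        refine Finset.sum_congr rfl fun x _ => ?_
        rw [count_roots]; ring
      _ ≤ 2 * G.natDegree * ((G.natDegree + G.natDegree) * h) := by
        gcongr; exact (card_roots' Q).trans hQdeg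
      _ = 4 * G.natDegree ^ 2 * h := by ring
  exact Nat.le_of_mul_le_mul_right this h0

/-- A monic bivariate polynomial is a product of powers of distinct monic irreducibles that depend
on the inner variable, times a factor that does not depend on it. -/
lemma exists_eq_mul_prod_pow {K : Type*} [Field K] {F : K[X][X]} (hF : F.Monic) :
    ∃ (P : K[X][X]) (T : Finset K[X][X]) (m : K[X][X] → ℕ), coeffDeriv P = 0 ∧
      (∀ g ∈ T, g.Monic ∧ Irreducible g ∧ coeffDeriv g ≠ 0 ∧ m g ≠ 0) ∧
      F = P * ∏ g ∈ T, g ^ m g := by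
  classical
  obtain ⟨s, hs, rfl⟩ := hF.exists_multiset_prod
  refine ⟨(s.filter fun g => coeffDeriv g = 0).prod, (s.filter fun g => ¬ coeffDeriv g = 0).toFinset,
    fun g => (s.filter fun g => ¬ coeffDeriv g = 0).count g, ?_, fun g hg => ?_, ?_⟩
  · refine Multiset.prod_induction (fun g => coeffDeriv g = 0) _ (fun f g hf hg => ?_)
      coeffDeriv_one fun g hg => (Multiset.mem_filter.1 hg).2
    rw [coeffDeriv_mul, hf, hg, zero_mul, mul_zero, add_zero]
  · rw [Multiset.mem_toFinset] at hg
    have hg' := Multiset.mem_filter.1 hg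
    exact ⟨(hs g hg'.1).1, (hs g hg'.1).2, hg'.2, (Multiset.count_pos.2 hg).ne'⟩
  · rw [← Finset.prod_multiset_count, Multiset.prod_filter_mul_prod_filter_not]

lemma le_of_prime_pow_dvd_pow_mul {R : Type*} [CommRing R] [IsDomain R] {π g H : R} {m n : ℕ}
    (hπ : Prime π) (hH : ¬ π ∣ H) (hg : ¬ π ^ 2 ∣ g) (h : π ^ n ∣ g ^ m * H) : n ≤ m := by
  by_cases hd : π ∣ g
  · obtain ⟨u, rfl⟩ := hd
    have hu : ¬ π ∣ u := fun hu => hg (by rw [sq]; exact mul_dvd_mul_left _ hu)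
    by_contra! hlt
    have h' : π ^ m * π ∣ π ^ m * (u ^ m * H) := by
      rw [← pow_succ, ← mul_assoc, ← mul_pow]
      exact (pow_dvd_pow _ hlt).trans h
    rcases hπ.dvd_or_dvd ((mul_dvd_mul_iff_left (pow_ne_zero _ hπ.ne_zero)).1 h') with h'' | h''
    exacts [hu (hπ.dvd_of_dvd_pow h''), hH h'']
  · rcases Nat.eq_zero_or_pos n with rfl | hn
    · exact Nat.zero_le _
    · rcases hπ.dvd_or_dvd ((dvd_pow_self π hn.ne').trans h) with h | h
      exacts [(hd (hπ.dvd_of_dvd_pow h)).elim, (hH h).elim]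

lemma eval_C_eq_C_of_coeffDeriv_eq_zero {K : Type*} [Field K] [CharZero K] {P : K[X][X]}
    (hP : coeffDeriv P = 0) (c : K) : ∃ k, P.eval (C c) = C k :=
  ⟨_, eq_C_of_derivative_eq_zero (by rw [← eval_C_coeffDeriv, hP, eval_zero])⟩

/-- A monic `F` of degree `n` with more than `4n² + 2n` specializations that are `n`-th powers either
does not depend on the inner variable or is the `n`-th power of a linear polynomial. -/
theorem coeffDeriv_eq_zero_or_eq_pow {K : Type*} [Field K] [IsAlgClosed K] [CharZero K] {n : ℕ}
    (hn : n ≠ 0) {F : K[X][X]} (hF : F.Monic) (hFn : F.natDegree = n) {B : Finset K}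
    (hB : 4 * n ^ 2 + 2 * n < B.card) (hpow : ∀ c ∈ B, ∃ v : K[X], F.eval (C c) = v ^ n) :
    coeffDeriv F = 0 ∨ ∃ ν : K[X], F = (X + C ν) ^ n := by
  classical
  obtain ⟨P, T, m, hP, hT, hfac⟩ := exists_eq_mul_prod_pow hF
  rcases T.eq_empty_or_nonempty with rfl | hTne
  · left
    rw [hfac, Finset.prod_empty, mul_one, hP]
  right
  by_cases hbig : ∃ g ∈ T, n ≤ m g
  · obtain ⟨g, hg, hng⟩ := hbig
    obtain ⟨hgm, hgi, -, -⟩ := hT g hg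
    have hdvd : g ^ n ∣ F := by
      rw [hfac]
      exact ((pow_dvd_pow g hng).trans (Finset.dvd_prod_of_mem (fun g => g ^ m g) hg)).mul_left _
    have hpos := hgm.natDegree_pos.2 hgi.ne_one
    have hle := natDegree_le_of_dvd hdvd hF.ne_zero
    rw [hgm.natDegree_pow, hFn] at hle
    have h1 : g.natDegree = 1 := le_antisymm (by nlinarith [Nat.pos_of_ne_zero hn]) hpos
    refine ⟨g.coeff 0, ?_⟩
    rw [← hgm.eq_X_add_C h1]
    refine eq_of_monic_of_dvd_of_natDegree_le (hgm.pow n) hF hdvd ?_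
    rw [hgm.natDegree_pow, hFn, h1, mul_one]
  exfalso
  push Not at hbig
  set G := ∏ g ∈ T, g with hGdef
  have hG : G.Monic := monic_prod_of_monic _ _ fun g hg => (hT g hg).1
  have hres : resultant G (coeffDeriv G) ≠ 0 := resultant_coeffDeriv_prod_ne_zero
    (fun g hg => (hT g hg).1) (fun g hg => (hT g hg).2.1) fun g hg => (hT g hg).2.2.1
  have hGF : G ∣ F := by
    rw [hfac]
    exact (Finset.prod_dvd_prod_of_dvd _ _ fun g hg => dvd_pow_self g (hT g hg).2.2.2).mul_left _
  have hGn : G.natDegree ≤ n := hFn ▸ natDegree_le_of_dvd hGF hF.ne_zero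
  have hG' : coeffDeriv G ≠ 0 := by
    obtain ⟨g, hg⟩ := hTne
    intro h
    refine not_dvd_coeffDeriv_prod (fun g hg => (hT g hg).1) (fun g hg => (hT g hg).2.1)
      (fun g hg => (hT g hg).2.2.1) hg ?_
    rw [← hGdef, h]
    exact dvd_zero g
  set Q := Bivariate.swap G with hQ
  have hQ0 : Q ≠ 0 := by simpa [hQ] using hG.ne_zero
  have hdeg : ∀ i, (G.coeff i).natDegree ≤ Q.natDegree := fun i => by
    rw [natDegree_le_iff_coeff_eq_zero]
    intro j hj
    rw [← coeff_coeff_swap, coeff_eq_zero_of_natDegree_lt hj, coeff_zero]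
  have hpos : 0 < Q.natDegree := by
    rw [Nat.pos_iff_ne_zero]
    intro h0
    refine hG' ?_
    ext1 i
    rw [coeff_coeffDeriv, coeff_zero]
    exact derivative_of_natDegree_zero (Nat.le_zero.1 (h0 ▸ hdeg i))
  have hQn : Q.leadingCoeff.natDegree ≤ n := by
    refine le_trans ?_ hGn
    rw [natDegree_le_iff_coeff_eq_zero]
    intro j hj
    rw [leadingCoeff, hQ, coeff_coeff_swap, coeff_eq_zero_of_natDegree_lt hj, coeff_zero]
  have hFroots : (B.filter fun c => F.eval (C c) = 0).card ≤ n := by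
    rw [← Finset.card_image_of_injective _ (C_injective (R := K)), ← hFn]
    refine card_le_degree_of_subset_roots fun r hr => ?_
    obtain ⟨c, hc, rfl⟩ := Finset.mem_image.1 hr
    rw [mem_roots hF.ne_zero]
    exact (Finset.mem_filter.1 hc).2
  have hQroots : (B.filter fun c => Q.leadingCoeff.eval c = 0).card ≤ n := by
    refine (card_le_degree_of_subset_roots fun c hc => ?_).trans hQn
    rw [mem_roots (leadingCoeff_ne_zero.2 hQ0)]
    exact (Finset.mem_filter.1 hc).2
  let S := B \ ((B.filter fun c => F.eval (C c) = 0) ∪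
    B.filter fun c => Q.leadingCoeff.eval c = 0)
  have hmemS : ∀ c ∈ S, c ∈ B ∧ F.eval (C c) ≠ 0 ∧ Q.leadingCoeff.eval c ≠ 0 := by
    intro c hc
    simp only [S, Finset.mem_sdiff, Finset.mem_union, Finset.mem_filter, not_or, not_and] at hc
    exact ⟨hc.1, hc.2.1 hc.1, hc.2.2 hc.1⟩
  have hScard : B.card ≤ S.card + (n + n) := by
    have h1 : B.card - _ ≤ S.card := Finset.le_card_sdiff _ B
    have h2 := (Finset.card_union_le _ _).trans (add_le_add hFroots hQroots)
    omega
  have hle : S.card ≤ 4 * G.natDegree ^ 2 := by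
    refine card_le_of_forall_root_multiple hG hres hpos hdeg (fun c hc => ?_) fun c hc x hx => ?_
    · refine natDegree_eq_of_le_of_coeff_ne_zero ?_ ?_
      · rw [natDegree_le_iff_coeff_eq_zero]
        intro j hj
        rw [coeff_eval_C, coeff_eq_zero_of_natDegree_lt hj, eval_zero]
      · rw [coeff_eval_C]
        exact (hmemS c hc).2.2
    · by_contra hsq
      obtain ⟨hcB, hF0, -⟩ := hmemS c hc
      have hπ := prime_X_sub_C x
      rw [← dvd_iff_isRoot] at hx
      have hGe : G.eval (C c) = ∏ g ∈ T, g.eval (C c) := eval_prod _ _ _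
      obtain ⟨g, hg, hxg⟩ := (hπ.dvd_finsetProd_iff _).1 (hGe ▸ hx)
      rw [hGe, ← Finset.mul_prod_erase T _ hg] at hsq
      have hrest : ¬ X - C x ∣ ∏ f ∈ T.erase g, f.eval (C c) := fun h =>
        hsq (by rw [sq]; exact mul_dvd_mul hxg h)
      obtain ⟨k, hk⟩ := eval_C_eq_C_of_coeffDeriv_eq_zero hP c
      have hFe : F.eval (C c) = g.eval (C c) ^ m g *
          (C k * ∏ f ∈ T.erase g, f.eval (C c) ^ m f) := by
        rw [hfac, eval_mul, hk, eval_prod]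
        simp only [eval_pow]
        rw [← Finset.mul_prod_erase T _ hg]
        ring
      have hk0 : k ≠ 0 := by
        rintro rfl
        exact hF0 (by rw [hFe, C_0, zero_mul, mul_zero])
      obtain ⟨v, hv⟩ := hpow c hcB
      have hxF : X - C x ∣ F.eval (C c) := by
        rw [hFe]
        exact (hxg.trans (dvd_pow_self _ (hT g hg).2.2.2)).mul_right _
      have hxn : (X - C x) ^ n ∣ F.eval (C c) := by
        rw [hv] at hxF ⊢
        exact pow_dvd_pow_of_dvd (hπ.dvd_of_dvd_pow hxF) n
      rw [hFe] at hxn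
      refine (hbig g hg).not_ge (le_of_prime_pow_dvd_pow_mul hπ (fun h => ?_)
        (fun h => hsq (h.mul_right _)) hxn)
      rcases hπ.dvd_or_dvd h with h | h
      · exact hπ.not_isUnit (isUnit_of_dvd_unit h (isUnit_C.2 hk0.isUnit))
      · obtain ⟨f, hf, hxf⟩ := (hπ.dvd_finsetProd_iff _).1 h
        exact hrest ((hπ.dvd_of_dvd_pow hxf).trans
          (Finset.dvd_prod_of_mem (fun f => f.eval (C c)) hf))
  have : 4 * G.natDegree ^ 2 ≤ 4 * n ^ 2 := by gcongr
  omega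

lemma four_mul_sq_add_lt {n : ℕ} (hn : 2 ≤ n) :
    4 * n ^ 2 + 2 * n < 2 * n ^ 2 * (n + 1) * Nat.choose (3 * n - 1) n := by
  have h1 : 0 < Nat.choose (3 * n - 1) n := Nat.choose_pos (by omega)
  calc 4 * n ^ 2 + 2 * n < 2 * n ^ 2 * (n + 1) * 1 := by nlinarith
    _ ≤ _ := by gcongr; exact h1

theorem buchi_problem_polynomial_ring
    {K : Type*} [Field K] [IsAlgClosed K] [CharZero K]
    (n : ℕ) (hn : 2 ≤ n)
    (a : Fin n → Polynomial K)
    (B : Finset K)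
    (hB : 2 * n ^ 2 * (n + 1) * Nat.choose (3 * n - 1) n ≤ B.card)
    (hpow : ∀ lam ∈ B, ∃ v : Polynomial K,
      Polynomial.eval ((C lam : Polynomial K))
        (X ^ n + ∑ i : Fin n, C (a i) * X ^ (i : ℕ) : Polynomial (Polynomial K)) = v ^ n) :
    (∀ i, ∃ k : K, a i = C k) ∨
    ∃ ν : Polynomial K,
      (X ^ n + ∑ i : Fin n, C (a i) * X ^ (i : ℕ) : Polynomial (Polynomial K))
        = (X + C ν) ^ n := by
  have hlt : (∑ i : Fin n, C (a i) * X ^ (i : ℕ) : K[X][X]).degree < n := degree_sum_fin_lt a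
  have hmon : (X ^ n + ∑ i : Fin n, C (a i) * X ^ (i : ℕ) : K[X][X]).Monic :=
    monic_X_pow_add hlt
  have hdeg : (X ^ n + ∑ i : Fin n, C (a i) * X ^ (i : ℕ) : K[X][X]).natDegree = n := by
    rw [natDegree_eq_of_degree_eq (degree_add_eq_left_of_degree_lt (by rwa [degree_X_pow])),
      natDegree_X_pow]
  refine (coeffDeriv_eq_zero_or_eq_pow (by omega) hmon hdeg
    ((four_mul_sq_add_lt hn).trans_le hB) hpow).imp_left fun h i => ?_
  have hi := congrArg (fun p => p.coeff (i : ℕ)) h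
  have hcoeff : (X ^ n + ∑ i : Fin n, C (a i) * X ^ (i : ℕ) : K[X][X]).coeff i = a i := by
    simp [coeff_X_pow, i.isLt.ne, Fin.val_inj]
  simp only [coeff_coeffDeriv, hcoeff, coeff_zero] at hi
  exact ⟨_, eq_C_of_derivative_eq_zero hi⟩
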